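/- arXiv:1401.6782 — 9 statements merged into one kernel-verified Lean document; each statement's English description precedes it below -/
import Mathlib

section
/- Let (B₁¹,B₂¹,i¹,j¹) and (B₁²,B₂²,i²,j²) be ADHM data on (W,V¹) and (W,V²) respectively, both satisfying the ADHM equation [B₁,B₂] + i∘j = 0. Then the composite b ∘ a is zero, i.e., the maps a and b form a complex of vector spaces Hom(V¹,V²) → Hom(V¹,V²)⊕Hom(V¹,V²)⊕Hom(W,V²)⊕Hom(V¹,W) → Hom(V¹,V²)⊕ℂ. -/
/- STATEMENT 0: For ADHM data (B₁¹,B₂¹,i¹,j¹) on (W,V¹) and (B₁²,B₂²,i²,j²) on (W,V²),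
both satisfying the ADHM equation [B₁,B₂] + i∘j = 0, the composite b ∘ a vanishes,
i.e. b(a ξ) = 0 for every ξ : V¹ → V². -/
theorem adhm_b_comp_a_eq_zero {W V1 V2 : Type*}
    [AddCommGroup W] [Module ℂ W] [FiniteDimensional ℂ W]
    [AddCommGroup V1] [Module ℂ V1] [FiniteDimensional ℂ V1]
    [AddCommGroup V2] [Module ℂ V2] [FiniteDimensional ℂ V2]
    (B11 B21 : V1 →ₗ[ℂ] V1) (i1 : W →ₗ[ℂ] V1) (j1 : V1 →ₗ[ℂ] W)
    (B12 B22 : V2 →ₗ[ℂ] V2) (i2 : W →ₗ[ℂ] V2) (j2 : V2 →ₗ[ℂ] W)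
    (hADHM1 : B11 ∘ₗ B21 - B21 ∘ₗ B11 + i1 ∘ₗ j1 = 0)
    (hADHM2 : B12 ∘ₗ B22 - B22 ∘ₗ B12 + i2 ∘ₗ j2 = 0) :
    ∀ ξ : V1 →ₗ[ℂ] V2,
      (B12 ∘ₗ (ξ ∘ₗ B21 - B22 ∘ₗ ξ) - (ξ ∘ₗ B21 - B22 ∘ₗ ξ) ∘ₗ B11
        + (ξ ∘ₗ B11 - B12 ∘ₗ ξ) ∘ₗ B21 - B22 ∘ₗ (ξ ∘ₗ B11 - B12 ∘ₗ ξ)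
        + i2 ∘ₗ (-(j2 ∘ₗ ξ)) + (ξ ∘ₗ i1) ∘ₗ j1 = 0)
      ∧ (LinearMap.trace ℂ V1 (i1 ∘ₗ (-(j2 ∘ₗ ξ)))
          + LinearMap.trace ℂ V2 ((ξ ∘ₗ i1) ∘ₗ j2) = 0) := by
  intro ξ
  constructor
  · ext x
    have h1 := congrArg ξ (LinearMap.congr_fun hADHM1 x)
    have h2 := LinearMap.congr_fun hADHM2 (ξ x)
    simp only [LinearMap.add_apply, LinearMap.sub_apply, LinearMap.comp_apply,
      LinearMap.zero_apply, map_add, map_sub, map_zero, LinearMap.neg_apply, map_neg] at h1 h2 ⊢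
    have h3 := congrArg₂ (fun a b => a - b) h1 h2
    simp only [sub_zero] at h3
    rw [← h3]
    abel
  · have h : LinearMap.trace ℂ V2 ((ξ ∘ₗ i1) ∘ₗ j2) = LinearMap.trace ℂ V1 ((i1 ∘ₗ j2) ∘ₗ ξ) := by
      rw [LinearMap.comp_assoc]
      exact LinearMap.trace_comp_comm' (i1 ∘ₗ j2) ξ
    rw [h, LinearMap.comp_neg, map_neg, LinearMap.comp_assoc]
    exact neg_add_cancel _
end

section
/- Let (B₁¹,B₂¹,i¹,j¹) be an ADHM datum on (W,V¹) which is stable, and (B₁²,B₂²,i²,j²) any ADHM datum on (W,V²). Then the linear map a is injective: if ξ : V¹ → V² satisfies ξB₁¹ = B₁²ξ, ξB₂¹ = B₂²ξ, ξ∘i¹ = 0 and j²∘ξ = 0, then ξ = 0. -/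
/- STATEMENT 1: If the ADHM datum (B₁¹,B₂¹,i¹,j¹) on (W,V¹) is stable, then the map a
is injective: any ξ : V¹ → V² with ξB₁¹ = B₁²ξ, ξB₂¹ = B₂²ξ, ξ∘i¹ = 0, j²∘ξ = 0 is zero. -/
theorem adhm_a_injective {W V1 V2 : Type*}
    [AddCommGroup W] [Module ℂ W] [FiniteDimensional ℂ W]
    [AddCommGroup V1] [Module ℂ V1] [FiniteDimensional ℂ V1]
    [AddCommGroup V2] [Module ℂ V2] [FiniteDimensional ℂ V2]
    (B11 B21 : V1 →ₗ[ℂ] V1) (i1 : W →ₗ[ℂ] V1) (j1 : V1 →ₗ[ℂ] W)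
    (B12 B22 : V2 →ₗ[ℂ] V2) (i2 : W →ₗ[ℂ] V2) (j2 : V2 →ₗ[ℂ] W)
    (hstab : ∀ U : Submodule ℂ V1, LinearMap.range i1 ≤ U →
      (∀ x ∈ U, B11 x ∈ U) → (∀ x ∈ U, B21 x ∈ U) → U = ⊤)
    (ξ : V1 →ₗ[ℂ] V2)
    (h1 : ξ ∘ₗ B11 = B12 ∘ₗ ξ) (h2 : ξ ∘ₗ B21 = B22 ∘ₗ ξ)
    (h3 : ξ ∘ₗ i1 = 0) (h4 : j2 ∘ₗ ξ = 0) :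
    ξ = 0 := by
  apply LinearMap.ker_eq_top.mp
  apply hstab
  · rintro _ ⟨w, rfl⟩
    exact LinearMap.congr_fun h3 w
  · intro x hx
    have h := LinearMap.congr_fun h1 x
    simp only [LinearMap.comp_apply, LinearMap.mem_ker] at h hx ⊢
    rw [h, hx, map_zero]
  · intro x hx
    have h := LinearMap.congr_fun h2 x
    simp only [LinearMap.comp_apply, LinearMap.mem_ker] at h hx ⊢
    rw [h, hx, map_zero]
end

section
/- Suppose dim V² < dim V¹, the ADHM datum (B₁¹,B₂¹,i¹,j¹) on (W,V¹) is stable, and the ADHM datum (B₁²,B₂²,i²,j²) on (W,V²) is stable. Then the linear map b : Hom(V¹,V²)⊕Hom(V¹,V²)⊕Hom(W,V²)⊕Hom(V¹,W) → Hom(V¹,V²)⊕ℂ is surjective. -/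
theorem aux_tr_nondeg {A B : Type*}
    [AddCommGroup A] [Module ℂ A] [FiniteDimensional ℂ A]
    [AddCommGroup B] [Module ℂ B] [FiniteDimensional ℂ B]
    (e : B →ₗ[ℂ] A) (h : ∀ C : A →ₗ[ℂ] B, LinearMap.trace ℂ A (e ∘ₗ C) = 0) : e = 0 := by
  ext v
  rw [LinearMap.zero_apply, ← Module.forall_dual_apply_eq_zero_iff ℂ]
  intro f
  have h1 := h (f.smulRight v)
  have h2 : e ∘ₗ (f.smulRight v) = f.smulRight (e v) := by
    ext x; simp
  rw [h2] at h1
  simpa using h1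

theorem aux_tr_rep {A B : Type*}
    [AddCommGroup A] [Module ℂ A] [FiniteDimensional ℂ A]
    [AddCommGroup B] [Module ℂ B] [FiniteDimensional ℂ B]
    (φ : (A →ₗ[ℂ] B) →ₗ[ℂ] ℂ) :
    ∃ e : B →ₗ[ℂ] A, ∀ C : A →ₗ[ℂ] B, φ C = LinearMap.trace ℂ A (e ∘ₗ C) := by
  let T : (B →ₗ[ℂ] A) →ₗ[ℂ] Module.Dual ℂ (A →ₗ[ℂ] B) :=
    LinearMap.mk₂ ℂ (fun e C => LinearMap.trace ℂ A (e ∘ₗ C))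
      (by intro a b c; simp [LinearMap.add_comp])
      (by intro a b c; simp [LinearMap.smul_comp])
      (by intro a b c; simp [LinearMap.comp_add])
      (by intro a b c; simp [LinearMap.comp_smul])
  have hinj : Function.Injective T := by
    rw [injective_iff_map_eq_zero]
    intro e he
    exact aux_tr_nondeg e fun C => by simpa [T] using LinearMap.congr_fun he C
  have hd : Module.finrank ℂ (B →ₗ[ℂ] A) = Module.finrank ℂ (Module.Dual ℂ (A →ₗ[ℂ] B)) := by
    rw [Subspace.dual_finrank_eq, Module.finrank_linearMap, Module.finrank_linearMap, mul_comm]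
  obtain ⟨e, he⟩ := (LinearMap.injective_iff_surjective_of_finrank_eq_finrank hd).1 hinj φ
  exact ⟨e, fun C => by rw [← he]; rfl⟩

/- STATEMENT 2: If dim V² < dim V¹ and both ADHM data are stable, then the map
b : Hom(V¹,V²)⊕Hom(V¹,V²)⊕Hom(W,V²)⊕Hom(V¹,W) → Hom(V¹,V²)⊕ℂ is surjective. -/
theorem adhm_b_surjective {W V1 V2 : Type*}
    [AddCommGroup W] [Module ℂ W] [FiniteDimensional ℂ W]
    [AddCommGroup V1] [Module ℂ V1] [FiniteDimensional ℂ V1]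
    [AddCommGroup V2] [Module ℂ V2] [FiniteDimensional ℂ V2]
    (B11 B21 : V1 →ₗ[ℂ] V1) (i1 : W →ₗ[ℂ] V1) (j1 : V1 →ₗ[ℂ] W)
    (B12 B22 : V2 →ₗ[ℂ] V2) (i2 : W →ₗ[ℂ] V2) (j2 : V2 →ₗ[ℂ] W)
    (hdim : Module.finrank ℂ V2 < Module.finrank ℂ V1)
    (hstab1 : ∀ U : Submodule ℂ V1, LinearMap.range i1 ≤ U →
      (∀ x ∈ U, B11 x ∈ U) → (∀ x ∈ U, B21 x ∈ U) → U = ⊤)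
    (hstab2 : ∀ U : Submodule ℂ V2, LinearMap.range i2 ≤ U →
      (∀ x ∈ U, B12 x ∈ U) → (∀ x ∈ U, B22 x ∈ U) → U = ⊤) :
    Function.Surjective
      (fun p : (V1 →ₗ[ℂ] V2) × (V1 →ₗ[ℂ] V2) × (W →ₗ[ℂ] V2) × (V1 →ₗ[ℂ] W) =>
        ((B12 ∘ₗ p.2.1 - p.2.1 ∘ₗ B11 + p.1 ∘ₗ B21 - B22 ∘ₗ p.1
            + i2 ∘ₗ p.2.2.2 + p.2.2.1 ∘ₗ j1,
          LinearMap.trace ℂ V1 (i1 ∘ₗ p.2.2.2) + LinearMap.trace ℂ V2 (p.2.2.1 ∘ₗ j2)) :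
          (V1 →ₗ[ℂ] V2) × ℂ)) := by
  classical
  let b : ((V1 →ₗ[ℂ] V2) × (V1 →ₗ[ℂ] V2) × (W →ₗ[ℂ] V2) × (V1 →ₗ[ℂ] W)) →ₗ[ℂ]
      ((V1 →ₗ[ℂ] V2) × ℂ) :=
    { toFun := fun p => (B12 ∘ₗ p.2.1 - p.2.1 ∘ₗ B11 + p.1 ∘ₗ B21 - B22 ∘ₗ p.1
            + i2 ∘ₗ p.2.2.2 + p.2.2.1 ∘ₗ j1,
          LinearMap.trace ℂ V1 (i1 ∘ₗ p.2.2.2) + LinearMap.trace ℂ V2 (p.2.2.1 ∘ₗ j2))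
      map_add' := by
        intro p q
        ext1
        · simp only [Prod.fst_add, Prod.snd_add, LinearMap.comp_add, LinearMap.add_comp]
          abel
        · simp only [Prod.fst_add, Prod.snd_add, LinearMap.comp_add, LinearMap.add_comp, map_add]
          abel
      map_smul' := by
        intro c p
        ext1
        · simp only [Prod.smul_fst, Prod.smul_snd, LinearMap.comp_smul, LinearMap.smul_comp,
            smul_add, smul_sub, RingHom.id_apply]
        · simp only [Prod.smul_fst, Prod.smul_snd, LinearMap.comp_smul, LinearMap.smul_comp,
            smul_add, map_smul, RingHom.id_apply] }
  change Function.Surjective b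
  rw [← LinearMap.range_eq_top]
  by_contra hne
  obtain ⟨f, hf0, hf⟩ := Submodule.exists_le_ker_of_lt_top _ (lt_top_iff_ne_top.2 hne)
  obtain ⟨e, he⟩ := aux_tr_rep (f ∘ₗ LinearMap.inl ℂ (V1 →ₗ[ℂ] V2) ℂ)
  obtain ⟨c, hc⟩ : ∃ c, c = f (0, 1) := ⟨_, rfl⟩
  have hfe : ∀ x y, f (x, y) = LinearMap.trace ℂ V1 (e ∘ₗ x) + c * y := by
    intro x y
    have h1 : ((x, y) : (V1 →ₗ[ℂ] V2) × ℂ) = (x, 0) + y • (0, 1) := by simp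
    have h2 := he x
    simp only [LinearMap.comp_apply, LinearMap.inl_apply] at h2
    rw [h1, map_add, map_smul, h2, ← hc, smul_eq_mul, mul_comm]
  have key : ∀ C1 C2 I J, LinearMap.trace ℂ V1 (e ∘ₗ (B12 ∘ₗ C2 - C2 ∘ₗ B11 + C1 ∘ₗ B21
      - B22 ∘ₗ C1 + i2 ∘ₗ J + I ∘ₗ j1)) + c * (LinearMap.trace ℂ V1 (i1 ∘ₗ J) +
      LinearMap.trace ℂ V2 (I ∘ₗ j2)) = 0 := by
    intro C1 C2 I J
    rw [← hfe]
    exact hf ⟨(C1, C2, I, J), rfl⟩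
  have k1 : e ∘ₗ B12 - B11 ∘ₗ e = 0 := by
    apply aux_tr_nondeg
    intro C
    have := key 0 C 0 0
    simp only [LinearMap.comp_zero, LinearMap.zero_comp, add_zero, sub_zero, map_zero, mul_zero,
      LinearMap.comp_sub, map_sub] at this
    rw [LinearMap.sub_comp, map_sub, LinearMap.comp_assoc, LinearMap.comp_assoc,
      LinearMap.trace_comp_comm' (e ∘ₗ C) B11, LinearMap.comp_assoc]
    exact this
  have k2 : B21 ∘ₗ e - e ∘ₗ B22 = 0 := by
    apply aux_tr_nondeg
    intro C
    have := key C 0 0 0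
    simp only [LinearMap.comp_zero, LinearMap.zero_comp, add_zero, zero_add, sub_zero, map_zero,
      mul_zero, LinearMap.comp_sub, map_sub] at this
    rw [LinearMap.sub_comp, map_sub, LinearMap.comp_assoc, LinearMap.comp_assoc,
      LinearMap.trace_comp_comm' (e ∘ₗ C) B21, LinearMap.comp_assoc]
    exact this
  have k3 : e ∘ₗ i2 + c • i1 = 0 := by
    apply aux_tr_nondeg
    intro C
    have := key 0 0 0 C
    simp only [LinearMap.comp_zero, LinearMap.zero_comp, add_zero, zero_add, sub_zero,
      map_zero] at this
    rw [LinearMap.add_comp, map_add, LinearMap.comp_assoc, LinearMap.smul_comp, map_smul,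
      smul_eq_mul]
    exact this
  have k1' : ∀ v, e (B12 v) = B11 (e v) := fun v => by
    simpa [sub_eq_zero] using LinearMap.congr_fun k1 v
  have k2' : ∀ v, B21 (e v) = e (B22 v) := fun v => by
    simpa [sub_eq_zero] using LinearMap.congr_fun k2 v
  have k3' : ∀ w, e (i2 w) + c • i1 w = 0 := fun w => by
    simpa using LinearMap.congr_fun k3 w
  by_cases c0 : c = 0
  · have ht : LinearMap.ker e = ⊤ := by
      apply hstab2
      · rintro _ ⟨w, rfl⟩
        simpa [c0] using k3' w
      · intro x hx
        rw [LinearMap.mem_ker] at hx ⊢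
        rw [k1', hx, map_zero]
      · intro x hx
        rw [LinearMap.mem_ker] at hx ⊢
        rw [← k2', hx, map_zero]
    rw [LinearMap.ker_eq_top] at ht
    apply hf0
    apply LinearMap.ext
    rintro ⟨x, y⟩
    rw [hfe, ht, c0]
    simp
  · have ht : LinearMap.range e = ⊤ := by
      apply hstab1
      · rintro _ ⟨w, rfl⟩
        refine ⟨-(c⁻¹ • i2 w), ?_⟩
        rw [map_neg, map_smul, eq_neg_of_add_eq_zero_left (k3' w), smul_neg, neg_neg,
          inv_smul_smul₀ c0]
      · rintro _ ⟨v, rfl⟩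
        exact ⟨_, k1' v⟩
      · rintro _ ⟨v, rfl⟩
        exact ⟨_, (k2' v).symm⟩
    rw [LinearMap.range_eq_top] at ht
    exact absurd (LinearMap.finrank_le_finrank_of_surjective ht) (not_le.2 hdim)
end

section
/- Suppose dim W = r, dim V¹ = n, dim V² = n−1 with n ≥ 1, both ADHM data satisfy the ADHM equation, and both are stable. Then the image of a is contained in the kernel of b, and the quotient vector space (ker b)/(im a) has dimension 2rn − r − 1. -/
section ADHM

variable {W V1 V2 : Type*}
  [AddCommGroup W] [Module ℂ W]
  [AddCommGroup V1] [Module ℂ V1]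
  [AddCommGroup V2] [Module ℂ V2]

/-- The linear map `a : Hom(V¹,V²) → Hom(V¹,V²)⊕Hom(V¹,V²)⊕Hom(W,V²)⊕Hom(V¹,W)`,
`a(ξ) = (ξB₁¹ − B₁²ξ, ξB₂¹ − B₂²ξ, ξ∘i¹, −j²∘ξ)`. -/
noncomputable def adhmA (B11 B21 : V1 →ₗ[ℂ] V1) (B12 B22 : V2 →ₗ[ℂ] V2)
    (i1 : W →ₗ[ℂ] V1) (j2 : V2 →ₗ[ℂ] W) :
    (V1 →ₗ[ℂ] V2) →ₗ[ℂ]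
      (V1 →ₗ[ℂ] V2) × (V1 →ₗ[ℂ] V2) × (W →ₗ[ℂ] V2) × (V1 →ₗ[ℂ] W) :=
  (LinearMap.lcomp ℂ V2 B11 - LinearMap.llcomp ℂ V1 V2 V2 B12).prod
    ((LinearMap.lcomp ℂ V2 B21 - LinearMap.llcomp ℂ V1 V2 V2 B22).prod
      ((LinearMap.lcomp ℂ V2 i1).prod (-(LinearMap.llcomp ℂ V1 V2 W j2))))

/-- The linear map `b : Hom(V¹,V²)⊕Hom(V¹,V²)⊕Hom(W,V²)⊕Hom(V¹,W) → Hom(V¹,V²)⊕ℂ`,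
`b(C₁,C₂,I,J) = (B₁²C₂ − C₂B₁¹ + C₁B₂¹ − B₂²C₁ + i²∘J + I∘j¹, tr(i¹∘J) + tr(I∘j²))`. -/
noncomputable def adhmB (B11 B21 : V1 →ₗ[ℂ] V1) (B12 B22 : V2 →ₗ[ℂ] V2)
    (i1 : W →ₗ[ℂ] V1) (j1 : V1 →ₗ[ℂ] W) (i2 : W →ₗ[ℂ] V2) (j2 : V2 →ₗ[ℂ] W) :
    ((V1 →ₗ[ℂ] V2) × (V1 →ₗ[ℂ] V2) × (W →ₗ[ℂ] V2) × (V1 →ₗ[ℂ] W)) →ₗ[ℂ]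
      (V1 →ₗ[ℂ] V2) × ℂ :=
  let π1 : ((V1 →ₗ[ℂ] V2) × (V1 →ₗ[ℂ] V2) × (W →ₗ[ℂ] V2) × (V1 →ₗ[ℂ] W)) →ₗ[ℂ]
      (V1 →ₗ[ℂ] V2) :=
    LinearMap.fst ℂ _ _
  let π2 : ((V1 →ₗ[ℂ] V2) × (V1 →ₗ[ℂ] V2) × (W →ₗ[ℂ] V2) × (V1 →ₗ[ℂ] W)) →ₗ[ℂ]
      (V1 →ₗ[ℂ] V2) :=
    (LinearMap.fst ℂ _ _) ∘ₗ (LinearMap.snd ℂ _ _)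
  let π3 : ((V1 →ₗ[ℂ] V2) × (V1 →ₗ[ℂ] V2) × (W →ₗ[ℂ] V2) × (V1 →ₗ[ℂ] W)) →ₗ[ℂ]
      (W →ₗ[ℂ] V2) :=
    (LinearMap.fst ℂ _ _) ∘ₗ (LinearMap.snd ℂ _ _) ∘ₗ (LinearMap.snd ℂ _ _)
  let π4 : ((V1 →ₗ[ℂ] V2) × (V1 →ₗ[ℂ] V2) × (W →ₗ[ℂ] V2) × (V1 →ₗ[ℂ] W)) →ₗ[ℂ]
      (V1 →ₗ[ℂ] W) :=
    (LinearMap.snd ℂ _ _) ∘ₗ (LinearMap.snd ℂ _ _) ∘ₗ (LinearMap.snd ℂ _ _)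
  ((LinearMap.llcomp ℂ V1 V2 V2 B12 - LinearMap.lcomp ℂ V2 B11) ∘ₗ π2
      + (LinearMap.lcomp ℂ V2 B21 - LinearMap.llcomp ℂ V1 V2 V2 B22) ∘ₗ π1
      + (LinearMap.llcomp ℂ V1 W V2 i2) ∘ₗ π4
      + (LinearMap.lcomp ℂ V2 j1) ∘ₗ π3).prod
    ((LinearMap.trace ℂ V1) ∘ₗ (LinearMap.llcomp ℂ V1 W V1 i1) ∘ₗ π4
      + (LinearMap.trace ℂ V2) ∘ₗ (LinearMap.lcomp ℂ V2 j2) ∘ₗ π3)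

end ADHM

theorem adhm_trace_nondeg {A B : Type*}
    [AddCommGroup A] [Module ℂ A] [FiniteDimensional ℂ A]
    [AddCommGroup B] [Module ℂ B] [FiniteDimensional ℂ B]
    (η : B →ₗ[ℂ] A) (h : ∀ X : A →ₗ[ℂ] B, LinearMap.trace ℂ A (η ∘ₗ X) = 0) : η = 0 := by
  ext v
  rw [LinearMap.zero_apply, ← Module.forall_dual_apply_eq_zero_iff ℂ]
  intro φ
  have := h (φ.smulRight v)
  have e : η ∘ₗ (φ.smulRight v) = φ.smulRight (η v) := by
    ext x; simp
  rwa [e, LinearMap.trace_smulRight] at this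

theorem adhm_trace_repr {A B : Type*}
    [AddCommGroup A] [Module ℂ A] [FiniteDimensional ℂ A]
    [AddCommGroup B] [Module ℂ B] [FiniteDimensional ℂ B]
    (f : (A →ₗ[ℂ] B) →ₗ[ℂ] ℂ) :
    ∃ η : B →ₗ[ℂ] A, ∀ X : A →ₗ[ℂ] B, f X = LinearMap.trace ℂ A (η ∘ₗ X) := by
  let T : (B →ₗ[ℂ] A) →ₗ[ℂ] Module.Dual ℂ (A →ₗ[ℂ] B) :=
    LinearMap.mk₂ ℂ (fun η X => LinearMap.trace ℂ A (η ∘ₗ X))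
      (by intros; simp [LinearMap.add_comp]) (by intros; simp [LinearMap.smul_comp])
      (by intros; simp [LinearMap.comp_add]) (by intros; simp [LinearMap.comp_smul])
  have hT : ∀ η X, T η X = LinearMap.trace ℂ A (η ∘ₗ X) := fun η X => rfl
  have hinj : Function.Injective T := by
    rw [injective_iff_map_eq_zero]
    intro η h
    apply adhm_trace_nondeg
    intro X
    rw [← hT, h]; rfl
  have hd : Module.finrank ℂ (B →ₗ[ℂ] A) = Module.finrank ℂ (Module.Dual ℂ (A →ₗ[ℂ] B)) := by
    rw [Subspace.dual_finrank_eq, Module.finrank_linearMap, Module.finrank_linearMap, mul_comm]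
  obtain ⟨η, h⟩ := (LinearMap.injective_iff_surjective_of_finrank_eq_finrank hd).1 hinj f
  exact ⟨η, fun X => by rw [← h]; rfl⟩

/- STATEMENT 3: If dim W = r, dim V¹ = n, dim V² = n−1 (n ≥ 1), both ADHM data satisfy
the ADHM equation and both are stable, then im a ⊆ ker b and dim (ker b / im a) = 2rn − r − 1. -/
theorem adhm_ker_b_mod_im_a_finrank {W V1 V2 : Type*}
    [AddCommGroup W] [Module ℂ W] [FiniteDimensional ℂ W]
    [AddCommGroup V1] [Module ℂ V1] [FiniteDimensional ℂ V1]
    [AddCommGroup V2] [Module ℂ V2] [FiniteDimensional ℂ V2]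
    (r n : ℕ) (hn : 1 ≤ n)
    (hW : Module.finrank ℂ W = r)
    (hV1 : Module.finrank ℂ V1 = n)
    (hV2 : Module.finrank ℂ V2 = n - 1)
    (B11 B21 : V1 →ₗ[ℂ] V1) (i1 : W →ₗ[ℂ] V1) (j1 : V1 →ₗ[ℂ] W)
    (B12 B22 : V2 →ₗ[ℂ] V2) (i2 : W →ₗ[ℂ] V2) (j2 : V2 →ₗ[ℂ] W)
    (hADHM1 : B11 ∘ₗ B21 - B21 ∘ₗ B11 + i1 ∘ₗ j1 = 0)
    (hADHM2 : B12 ∘ₗ B22 - B22 ∘ₗ B12 + i2 ∘ₗ j2 = 0)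
    (hstab1 : ∀ U : Submodule ℂ V1, LinearMap.range i1 ≤ U →
      (∀ x ∈ U, B11 x ∈ U) → (∀ x ∈ U, B21 x ∈ U) → U = ⊤)
    (hstab2 : ∀ U : Submodule ℂ V2, LinearMap.range i2 ≤ U →
      (∀ x ∈ U, B12 x ∈ U) → (∀ x ∈ U, B22 x ∈ U) → U = ⊤) :
    LinearMap.range (adhmA B11 B21 B12 B22 i1 j2)
        ≤ LinearMap.ker (adhmB B11 B21 B12 B22 i1 j1 i2 j2)
    ∧ Module.finrank ℂ
        (↥(LinearMap.ker (adhmB B11 B21 B12 B22 i1 j1 i2 j2)) ⧸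
          Submodule.comap (LinearMap.ker (adhmB B11 B21 B12 B22 i1 j1 i2 j2)).subtype
            (LinearMap.range (adhmA B11 B21 B12 B22 i1 j2)))
      = 2 * r * n - r - 1 := by
  set a := adhmA B11 B21 B12 B22 i1 j2 with ha
  set b := adhmB B11 B21 B12 B22 i1 j1 i2 j2 with hb
  have hle : LinearMap.range a ≤ LinearMap.ker b := by
    rintro _ ⟨ξ, rfl⟩
    rw [LinearMap.mem_ker]
    apply Prod.ext
    · ext x
      have h1 := congrArg ξ (LinearMap.congr_fun hADHM1 x)
      have h2 := LinearMap.congr_fun hADHM2 (ξ x)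
      simp [ha, hb, adhmA, adhmB] at h1 h2 ⊢
      linear_combination (norm := module) h1 - h2
    · have h := LinearMap.trace_comp_comm' ξ (i1 ∘ₗ j2)
      have e1 : (b (a ξ)).2 = LinearMap.trace ℂ V1 (i1 ∘ₗ (-(j2 ∘ₗ ξ)))
        + LinearMap.trace ℂ V2 ((ξ ∘ₗ i1) ∘ₗ j2) := rfl
      rw [e1, LinearMap.comp_neg, map_neg, ← LinearMap.comp_assoc, h, LinearMap.comp_assoc]
      simp
  refine ⟨hle, ?_⟩
  have hainj : Function.Injective a := by
    rw [injective_iff_map_eq_zero]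
    intro ξ h
    have h1 : ξ ∘ₗ B11 - B12 ∘ₗ ξ = 0 := congrArg (fun p => p.1) h
    have h2 : ξ ∘ₗ B21 - B22 ∘ₗ ξ = 0 := congrArg (fun p => p.2.1) h
    have h3 : ξ ∘ₗ i1 = 0 := congrArg (fun p => p.2.2.1) h
    have := hstab1 (LinearMap.ker ξ) ?_ ?_ ?_
    · exact LinearMap.ker_eq_top.1 this
    · rintro _ ⟨w, rfl⟩
      exact LinearMap.congr_fun h3 w
    · intro x hx
      have := LinearMap.congr_fun h1 x
      simp only [LinearMap.mem_ker] at hx ⊢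
      simpa [hx] using this
    · intro x hx
      have := LinearMap.congr_fun h2 x
      simp only [LinearMap.mem_ker] at hx ⊢
      simpa [hx] using this
  have hbsurj : LinearMap.range b = ⊤ := by
    by_contra hne
    obtain ⟨f, hf0, hf⟩ := Submodule.exists_le_ker_of_lt_top _ (lt_top_iff_ne_top.2 hne)
    obtain ⟨η, hη⟩ := adhm_trace_repr (f ∘ₗ LinearMap.inl ℂ (V1 →ₗ[ℂ] V2) ℂ)
    obtain ⟨l, hl⟩ : ∃ l : ℂ, l = f (0, 1) := ⟨_, rfl⟩
    have hfeq : ∀ X c, f (X, c) = LinearMap.trace ℂ V1 (η ∘ₗ X) + c * l := by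
      intro X c
      rw [← hη, hl]
      have : (X, c) = LinearMap.inl ℂ (V1 →ₗ[ℂ] V2) ℂ X + c • ((0, 1) : (V1 →ₗ[ℂ] V2) × ℂ) := by
        simp
      rw [this, map_add, map_smul]; rfl
    have key : ∀ C1 C2 I J, LinearMap.trace ℂ V1 (η ∘ₗ (B12 ∘ₗ C2 - C2 ∘ₗ B11
        + (C1 ∘ₗ B21 - B22 ∘ₗ C1) + i2 ∘ₗ J + I ∘ₗ j1))
        + (LinearMap.trace ℂ V1 (i1 ∘ₗ J) + LinearMap.trace ℂ V2 (I ∘ₗ j2)) * l = 0 := by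
      intro C1 C2 I J
      rw [← hfeq]
      exact hf ⟨(C1, C2, I, J), rfl⟩
    have k1 : B21 ∘ₗ η - η ∘ₗ B22 = 0 := by
      apply adhm_trace_nondeg
      intro C
      have h := key C 0 0 0
      have hc := LinearMap.trace_comp_comm' B21 (η ∘ₗ C)
      simp only [LinearMap.comp_sub, LinearMap.sub_comp, map_sub, LinearMap.comp_zero,
        LinearMap.zero_comp, map_zero, LinearMap.comp_add, map_add, LinearMap.comp_assoc] at h hc ⊢
      linear_combination h - hc
    have k2 : η ∘ₗ B12 - B11 ∘ₗ η = 0 := by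
      apply adhm_trace_nondeg
      intro C
      have h := key 0 C 0 0
      have hc := LinearMap.trace_comp_comm' B11 (η ∘ₗ C)
      simp only [LinearMap.comp_sub, LinearMap.sub_comp, map_sub, LinearMap.comp_zero,
        LinearMap.zero_comp, map_zero, LinearMap.comp_add, map_add, LinearMap.comp_assoc] at h hc ⊢
      linear_combination h + hc
    have k3 : η ∘ₗ i2 + l • i1 = 0 := by
      apply adhm_trace_nondeg
      intro J
      have h := key 0 0 0 J
      simp only [LinearMap.comp_sub, LinearMap.sub_comp, map_sub, LinearMap.comp_zero,
        LinearMap.zero_comp, map_zero, LinearMap.comp_add, map_add, LinearMap.comp_assoc,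
        LinearMap.add_comp, LinearMap.smul_comp, map_smul, smul_eq_mul] at h ⊢
      linear_combination h
    have c1 : ∀ x, B21 (η x) = η (B22 x) := fun x => sub_eq_zero.1 (LinearMap.congr_fun k1 x)
    have c2 : ∀ x, η (B12 x) = B11 (η x) := fun x => sub_eq_zero.1 (LinearMap.congr_fun k2 x)
    have c3 : ∀ w, η (i2 w) + l • i1 w = 0 := fun w => LinearMap.congr_fun k3 w
    by_cases h0 : l = 0
    · have hη0 : η = 0 := by
        apply LinearMap.ker_eq_top.1
        apply hstab2
        · rintro _ ⟨w, rfl⟩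
          simpa [h0] using c3 w
        · intro x hx
          rw [LinearMap.mem_ker] at hx ⊢
          rw [c2, hx, map_zero]
        · intro x hx
          rw [LinearMap.mem_ker] at hx ⊢
          rw [← c1, hx, map_zero]
      apply hf0
      apply LinearMap.ext
      rintro ⟨X, c⟩
      rw [hfeq, hη0, h0]; simp
    · have ht : LinearMap.range η = ⊤ := by
        apply hstab1
        · rintro _ ⟨w, rfl⟩
          refine ⟨-(l⁻¹ • i2 w), ?_⟩
          rw [map_neg, map_smul, eq_neg_of_add_eq_zero_left (c3 w), smul_neg, neg_neg,
            inv_smul_smul₀ h0]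
        · rintro _ ⟨x, rfl⟩
          exact ⟨_, c2 x⟩
        · rintro _ ⟨x, rfl⟩
          exact ⟨_, (c1 x).symm⟩
      have := LinearMap.finrank_range_le η
      rw [ht, finrank_top] at this
      omega
  have e1 := Submodule.finrank_quotient_add_finrank
    (Submodule.comap (LinearMap.ker b).subtype (LinearMap.range a))
  have e2 := (Submodule.comapSubtypeEquivOfLe hle).finrank_eq
  have e3 := LinearMap.finrank_range_of_inj hainj
  have e4 := LinearMap.finrank_range_add_finrank_ker b
  rw [hbsurj, finrank_top] at e4
  simp only [Module.finrank_prod, Module.finrank_linearMap, Module.finrank_self, hW, hV1, hV2]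
    at e3 e4
  obtain ⟨m, rfl⟩ : ∃ m, n = m + 1 := ⟨n - 1, by omega⟩
  rw [Nat.add_sub_cancel] at e3 e4
  rw [e2, e3] at e1
  rw [← e1] at e4
  generalize Module.finrank ℂ (↥(LinearMap.ker b) ⧸
    Submodule.comap (LinearMap.ker b).subtype (LinearMap.range a)) = q at *
  have : 2 * r * (m + 1) = q + 1 + r := by linarith
  omega
end

section
/- Suppose dim V² < dim V¹, the ADHM datum (B₁¹,B₂¹,i¹,j¹) on (W,V¹) is stable, and the ADHM datum (B₁²,B₂²,i²,j²) on (W,V²) is stable. If ζ : V² → V¹ is a linear map and λ ∈ ℂ a scalar satisfying ζB₁² = B₁¹ζ, ζB₂² = B₂¹ζ, ζ∘i² + λ·i¹ = 0 and j¹∘ζ + λ·j² = 0, then ζ = 0 and λ = 0. -/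
/- STATEMENT 4: Suppose dim V² < dim V¹ and both ADHM data are stable. If ζ : V² → V¹
and λ ∈ ℂ satisfy ζB₁² = B₁¹ζ, ζB₂² = B₂¹ζ, ζ∘i² + λ·i¹ = 0, j¹∘ζ + λ·j² = 0,
then ζ = 0 and λ = 0. -/
theorem adhm_zeta_lambda_zero {W V1 V2 : Type*}
    [AddCommGroup W] [Module ℂ W] [FiniteDimensional ℂ W]
    [AddCommGroup V1] [Module ℂ V1] [FiniteDimensional ℂ V1]
    [AddCommGroup V2] [Module ℂ V2] [FiniteDimensional ℂ V2]
    (B11 B21 : V1 →ₗ[ℂ] V1) (i1 : W →ₗ[ℂ] V1) (j1 : V1 →ₗ[ℂ] W)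
    (B12 B22 : V2 →ₗ[ℂ] V2) (i2 : W →ₗ[ℂ] V2) (j2 : V2 →ₗ[ℂ] W)
    (hdim : Module.finrank ℂ V2 < Module.finrank ℂ V1)
    (hstab1 : ∀ U : Submodule ℂ V1, LinearMap.range i1 ≤ U →
      (∀ x ∈ U, B11 x ∈ U) → (∀ x ∈ U, B21 x ∈ U) → U = ⊤)
    (hstab2 : ∀ U : Submodule ℂ V2, LinearMap.range i2 ≤ U →
      (∀ x ∈ U, B12 x ∈ U) → (∀ x ∈ U, B22 x ∈ U) → U = ⊤)
    (ζ : V2 →ₗ[ℂ] V1) (lam : ℂ)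
    (h1 : ζ ∘ₗ B12 = B11 ∘ₗ ζ) (h2 : ζ ∘ₗ B22 = B21 ∘ₗ ζ)
    (h3 : ζ ∘ₗ i2 + lam • i1 = 0) (h4 : j1 ∘ₗ ζ + lam • j2 = 0) :
    ζ = 0 ∧ lam = 0 := by
  have e1 : ∀ x, ζ (B12 x) = B11 (ζ x) := fun x => LinearMap.congr_fun h1 x
  have e2 : ∀ x, ζ (B22 x) = B21 (ζ x) := fun x => LinearMap.congr_fun h2 x
  have e3 : ∀ w, ζ (i2 w) + lam • i1 w = 0 := fun w => LinearMap.congr_fun h3 w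
  have hl : lam = 0 := by
    by_contra hne
    have htop : LinearMap.range ζ = ⊤ := by
      apply hstab1
      · rintro _ ⟨w, rfl⟩
        refine ⟨-(lam⁻¹ • i2 w), ?_⟩
        rw [map_neg, map_smul, eq_neg_of_add_eq_zero_left (e3 w), smul_neg, neg_neg,
          smul_smul, inv_mul_cancel₀ hne, one_smul]
      · rintro _ ⟨y, rfl⟩
        exact ⟨B12 y, e1 y⟩
      · rintro _ ⟨y, rfl⟩
        exact ⟨B22 y, e2 y⟩
    have hle := LinearMap.finrank_range_le ζ
    rw [htop, finrank_top] at hle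
    omega
  refine ⟨?_, hl⟩
  subst hl
  rw [← LinearMap.ker_eq_top]
  apply hstab2
  · rintro _ ⟨w, rfl⟩
    simpa using e3 w
  · intro x hx
    rw [LinearMap.mem_ker] at hx ⊢
    rw [e1, hx, map_zero]
  · intro x hx
    rw [LinearMap.mem_ker] at hx ⊢
    rw [e2, hx, map_zero]
end

section
/- Suppose dim V¹ = n, dim V² = n−1 with n ≥ 1, and the ADHM datum (B₁²,B₂²,i²,j²) on (W,V²) is stable. Let ξ : V¹ → V² be a linear map satisfying ξB₁¹ = B₁²ξ, ξB₂¹ = B₂²ξ and ξ∘i¹ = i². Then ξ is surjective, its kernel is one-dimensional, and both B₁¹ and B₂¹ map ker ξ into itself; moreover, if in addition j¹ = j²∘ξ, then j¹ vanishes on ker ξ. -/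
/- STATEMENT 5: Suppose dim V¹ = n, dim V² = n−1 (n ≥ 1) and the ADHM datum on (W,V²)
is stable. If ξ : V¹ → V² satisfies ξB₁¹ = B₁²ξ, ξB₂¹ = B₂²ξ and ξ∘i¹ = i², then ξ is
surjective, ker ξ is one-dimensional, B₁¹ and B₂¹ preserve ker ξ; and if moreover
j¹ = j²∘ξ then j¹ vanishes on ker ξ. -/
theorem adhm_hecke_kernel {W V1 V2 : Type*}
    [AddCommGroup W] [Module ℂ W] [FiniteDimensional ℂ W]
    [AddCommGroup V1] [Module ℂ V1] [FiniteDimensional ℂ V1]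
    [AddCommGroup V2] [Module ℂ V2] [FiniteDimensional ℂ V2]
    (n : ℕ) (hn : 1 ≤ n)
    (hV1 : Module.finrank ℂ V1 = n)
    (hV2 : Module.finrank ℂ V2 = n - 1)
    (B11 B21 : V1 →ₗ[ℂ] V1) (i1 : W →ₗ[ℂ] V1) (j1 : V1 →ₗ[ℂ] W)
    (B12 B22 : V2 →ₗ[ℂ] V2) (i2 : W →ₗ[ℂ] V2) (j2 : V2 →ₗ[ℂ] W)
    (hstab2 : ∀ U : Submodule ℂ V2, LinearMap.range i2 ≤ U →
      (∀ x ∈ U, B12 x ∈ U) → (∀ x ∈ U, B22 x ∈ U) → U = ⊤)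
    (ξ : V1 →ₗ[ℂ] V2)
    (h1 : ξ ∘ₗ B11 = B12 ∘ₗ ξ) (h2 : ξ ∘ₗ B21 = B22 ∘ₗ ξ)
    (h3 : ξ ∘ₗ i1 = i2) :
    Function.Surjective ξ
    ∧ Module.finrank ℂ (LinearMap.ker ξ) = 1
    ∧ (∀ x ∈ LinearMap.ker ξ, B11 x ∈ LinearMap.ker ξ)
    ∧ (∀ x ∈ LinearMap.ker ξ, B21 x ∈ LinearMap.ker ξ)
    ∧ (j1 = j2 ∘ₗ ξ → ∀ x ∈ LinearMap.ker ξ, j1 x = 0) := by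
  have e1 : ∀ x, ξ (B11 x) = B12 (ξ x) := fun x => LinearMap.congr_fun h1 x
  have e2 : ∀ x, ξ (B21 x) = B22 (ξ x) := fun x => LinearMap.congr_fun h2 x
  have e3 : ∀ x, ξ (i1 x) = i2 x := fun x => LinearMap.congr_fun h3 x
  have hr : LinearMap.range ξ = ⊤ := by
    apply hstab2
    · rintro _ ⟨w, rfl⟩
      exact ⟨i1 w, e3 w⟩
    · rintro _ ⟨x, rfl⟩
      exact ⟨B11 x, e1 x⟩
    · rintro _ ⟨x, rfl⟩
      exact ⟨B21 x, e2 x⟩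
  refine ⟨LinearMap.range_eq_top.mp hr, ?_, ?_, ?_, ?_⟩
  · have h := LinearMap.finrank_range_add_finrank_ker ξ
    rw [hr, finrank_top, hV1, hV2] at h
    omega
  · intro x hx
    rw [LinearMap.mem_ker] at hx ⊢
    rw [e1, hx, map_zero]
  · intro x hx
    rw [LinearMap.mem_ker] at hx ⊢
    rw [e2, hx, map_zero]
  · intro hj x hx
    rw [LinearMap.mem_ker] at hx
    rw [hj, LinearMap.comp_apply, hx, map_zero]
end

section
/- Let I ⊆ R = ℂ[z,ξ] be an ideal such that R/I is a finite-dimensional complex vector space. Then for every i ≥ 1 one has λ'_i(I) ≥ λ'_{i+1}(I); that is, the sequence (λ'_1(I), λ'_2(I), …) is weakly decreasing, hence is a partition. -/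
open MvPolynomial

/-- `λ'_i(I) = dim_ℂ ( (ξ^{i−1}) / ( I ∩ (ξ^{i−1}) + (ξ^i) ) )`, where `R = ℂ[z,ξ]`
(with `z = X 0`, `ξ = X 1`) and `(ξ^k)` is the principal ideal generated by `ξ^k`. -/
noncomputable def lambdaPrime (I : Ideal (MvPolynomial (Fin 2) ℂ)) (i : ℕ) : ℕ :=
  let A : Submodule ℂ (MvPolynomial (Fin 2) ℂ) :=
    (Ideal.span {(X 1 : MvPolynomial (Fin 2) ℂ) ^ (i - 1)}).restrictScalars ℂ
  let B : Submodule ℂ (MvPolynomial (Fin 2) ℂ) :=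
    (I.restrictScalars ℂ ⊓ A) + (Ideal.span {(X 1 : MvPolynomial (Fin 2) ℂ) ^ i}).restrictScalars ℂ
  Module.finrank ℂ (↥A ⧸ Submodule.comap A.subtype B)

/- STATEMENT 6: If R/I is finite dimensional over ℂ, then the sequence (λ'_1(I), λ'_2(I), …)
is weakly decreasing, i.e. λ'_{i+1}(I) ≤ λ'_i(I) for all i ≥ 1. -/
theorem lambdaPrime_antitone (I : Ideal (MvPolynomial (Fin 2) ℂ))
    (hI : FiniteDimensional ℂ (MvPolynomial (Fin 2) ℂ ⧸ I)) :
    ∀ i : ℕ, 1 ≤ i → lambdaPrime I (i + 1) ≤ lambdaPrime I i := by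
  intro i hi
  obtain ⟨k, rfl⟩ : ∃ k, i = k + 1 := ⟨i - 1, by omega⟩
  unfold lambdaPrime
  set S : ℕ → Submodule ℂ (MvPolynomial (Fin 2) ℂ) := fun n =>
    (Ideal.span {(X 1 : MvPolynomial (Fin 2) ℂ) ^ n}).restrictScalars ℂ with hS
  have memS : ∀ n p, p ∈ S n ↔ ∃ q, p = X 1 ^ n * q := by
    intro n p
    simp only [hS, Submodule.restrictScalars_mem, Ideal.mem_span_singleton]
    rfl
  have hmul : ∀ n, ∀ p ∈ S n, LinearMap.mulLeft ℂ (X 1 : MvPolynomial (Fin 2) ℂ) p ∈ S (n + 1) := by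
    intro n p hp
    obtain ⟨q, rfl⟩ := (memS _ _).1 hp
    exact (memS _ _).2 ⟨q, by simp only [LinearMap.mulLeft_apply]; ring⟩
  set B : ℕ → Submodule ℂ (MvPolynomial (Fin 2) ℂ) := fun n =>
    (I.restrictScalars ℂ ⊓ S n) + S (n + 1) with hB
  have hmulB : ∀ n, ∀ p ∈ B n, LinearMap.mulLeft ℂ (X 1 : MvPolynomial (Fin 2) ℂ) p ∈ B (n + 1) := by
    intro n p hp
    obtain ⟨a, ha, b, hb, rfl⟩ := Submodule.mem_sup.1 hp
    rw [map_add]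
    exact Submodule.mem_sup.2 ⟨_, ⟨I.mul_mem_left _ ha.1, hmul _ _ ha.2⟩, _, hmul _ _ hb, rfl⟩
  let f : S k →ₗ[ℂ] S (k + 1) := (LinearMap.mulLeft ℂ (X 1)).restrict (hmul k)
  have hf : Function.Surjective f := by
    rintro ⟨p, hp⟩
    obtain ⟨q, rfl⟩ := (memS _ _).1 hp
    refine ⟨⟨X 1 ^ k * q, (memS _ _).2 ⟨q, rfl⟩⟩, Subtype.ext ?_⟩
    change X 1 * (X 1 ^ k * q) = _
    ring
  have hfin : FiniteDimensional ℂ (S k ⧸ (B k).comap (S k).subtype) := by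
    let g : S k →ₗ[ℂ] (MvPolynomial (Fin 2) ℂ ⧸ I) :=
      (Ideal.Quotient.mkₐ ℂ I).toLinearMap ∘ₗ (S k).subtype
    have hg : LinearMap.ker g ≤ (B k).comap (S k).subtype := by
      intro x hx
      have hx' : (x : MvPolynomial (Fin 2) ℂ) ∈ I := Ideal.Quotient.eq_zero_iff_mem.1 hx
      exact Submodule.mem_sup_left ⟨hx', x.2⟩
    have h1 : FiniteDimensional ℂ (S k ⧸ LinearMap.ker g) :=
      Module.Finite.equiv g.quotKerEquivRange.symm
    exact Module.Finite.of_surjective _ (Submodule.factor_surjective hg)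
  have hle : (B k).comap (S k).subtype ≤ ((B (k + 1)).comap (S (k + 1)).subtype).comap f :=
    fun x hx => hmulB k _ hx
  have key : Module.finrank ℂ (S (k + 1) ⧸ (B (k + 1)).comap (S (k + 1)).subtype) ≤
      Module.finrank ℂ (S k ⧸ (B k).comap (S k).subtype) := by
   refine LinearMap.finrank_le_finrank_of_surjective
    (f := Submodule.mapQ ((B k).comap (S k).subtype) ((B (k + 1)).comap (S (k + 1)).subtype) f hle) ?_
   intro y
   obtain ⟨y, rfl⟩ := Submodule.Quotient.mk_surjective _ y
   obtain ⟨x, rfl⟩ := hf y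
   exact ⟨Submodule.Quotient.mk x, rfl⟩
  exact key
end

section
/- Let I ⊆ R = ℂ[z,ξ] be an ideal with dim_ℂ(R/I) = n and ξⁿ ∈ I. Then λ'_i(I) = 0 for all i > n, and the sum λ'_1(I) + λ'_2(I) + ⋯ + λ'_n(I) equals n. -/
open MvPolynomial

theorem aux_step {M : Type*} [AddCommGroup M] [Module ℂ M] (A A' J : Submodule ℂ M)
    (h : A' ≤ A) [FiniteDimensional ℂ (M ⧸ J)] :
    Module.finrank ℂ (↥A ⧸ Submodule.comap A.subtype ((J ⊓ A) + A'))
      + Module.finrank ℂ (A'.map J.mkQ) = Module.finrank ℂ (A.map J.mkQ) := by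
  have hV : A'.map J.mkQ ≤ A.map J.mkQ := Submodule.map_mono h
  let f : A →ₗ[ℂ] A.map J.mkQ := J.mkQ.submoduleMap A
  have hf : Function.Surjective f := J.mkQ.submoduleMap_surjective A
  let W := Submodule.comap (A.map J.mkQ).subtype (A'.map J.mkQ)
  let g := W.mkQ ∘ₗ f
  have hg : Function.Surjective g := (Submodule.mkQ_surjective W).comp hf
  have hk : Submodule.comap A.subtype ((J ⊓ A) + A') = LinearMap.ker g := by
    ext x
    have h1 : x ∈ LinearMap.ker g ↔ J.mkQ (x : M) ∈ A'.map J.mkQ := by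
      simp only [g, LinearMap.mem_ker, LinearMap.comp_apply, Submodule.mkQ_apply,
        Submodule.Quotient.mk_eq_zero]
      rfl
    rw [h1, Submodule.mem_comap, Submodule.add_eq_sup, Submodule.mem_sup, Submodule.mem_map]
    constructor
    · rintro ⟨y, hy, z, hz, e⟩
      refine ⟨z, hz, ?_⟩
      rw [← sub_eq_zero, ← map_sub, Submodule.mkQ_apply, Submodule.Quotient.mk_eq_zero]
      have : z - (x : M) = -y := by
        have e' : y + z = (x : M) := e
        rw [← e']; abel
      rw [this]; exact J.neg_mem hy.1
    · rintro ⟨z, hz, e⟩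
      rw [eq_comm, ← sub_eq_zero, ← map_sub, Submodule.mkQ_apply,
        Submodule.Quotient.mk_eq_zero] at e
      exact ⟨x - z, ⟨e, A.sub_mem x.2 (h hz)⟩, z, hz, by simp⟩
  rw [hk, (g.quotKerEquivOfSurjective hg).finrank_eq,
    ← (Submodule.comapSubtypeEquivOfLe hV).finrank_eq]
  exact Submodule.finrank_quotient_add_finrank W

theorem lambdaPrime_sum_eq (I : Ideal (MvPolynomial (Fin 2) ℂ)) (n : ℕ)
    (hI : Module.finrank ℂ (MvPolynomial (Fin 2) ℂ ⧸ I) = n)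
    (hxi : (X 1 : MvPolynomial (Fin 2) ℂ) ^ n ∈ I) :
    (∀ i : ℕ, n < i → lambdaPrime I i = 0)
    ∧ ∑ i ∈ Finset.Icc 1 n, lambdaPrime I i = n := by
  let S : ℕ → Submodule ℂ (MvPolynomial (Fin 2) ℂ) := fun k =>
    (Ideal.span {(X 1 : MvPolynomial (Fin 2) ℂ) ^ k}).restrictScalars ℂ
  let J : Submodule ℂ (MvPolynomial (Fin 2) ℂ) := I.restrictScalars ℂ
  have hS : ∀ k, S (k + 1) ≤ S k := fun k => by
    intro x hx
    exact Ideal.span_singleton_le_span_singleton.2 (pow_dvd_pow _ k.le_succ) hx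
  have hSJ : ∀ k, n ≤ k → S k ≤ J := fun k hk x hx => by
    have h1 : Ideal.span {(X 1 : MvPolynomial (Fin 2) ℂ) ^ k} ≤ I := by
      rw [Ideal.span_singleton_le_iff_mem]
      exact I.mem_of_dvd (pow_dvd_pow _ hk) hxi
    exact h1 hx
  have hJ : Module.finrank ℂ (MvPolynomial (Fin 2) ℂ ⧸ J) = n := hI
  have fd : FiniteDimensional ℂ (MvPolynomial (Fin 2) ℂ ⧸ J) := by
    rcases Nat.eq_zero_or_pos n with h0 | h0
    · have : J = ⊤ := by
        have h1 : I = ⊤ := by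
          rw [Ideal.eq_top_iff_one]; simpa [h0] using hxi
        simp [J, h1]
      have : Subsingleton (MvPolynomial (Fin 2) ℂ ⧸ J) := Submodule.Quotient.subsingleton_iff.2 this
      infer_instance
    · exact FiniteDimensional.of_finrank_pos (by omega)
  have step : ∀ k, lambdaPrime I (k + 1) + Module.finrank ℂ ((S (k+1)).map J.mkQ)
      = Module.finrank ℂ ((S k).map J.mkQ) := fun k => aux_step (S k) (S (k+1)) J (hS k)
  have hz : ∀ k, n ≤ k → Module.finrank ℂ ((S k).map J.mkQ) = 0 := fun k hk => by
    have : (S k).map J.mkQ = ⊥ := by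
      rw [← le_bot_iff, Submodule.map_le_iff_le_comap, Submodule.comap_bot, Submodule.ker_mkQ]
      exact hSJ k hk
    rw [this]; exact finrank_bot _ _
  have tel : ∀ m, ∑ i ∈ Finset.Icc 1 m, lambdaPrime I i
      + Module.finrank ℂ ((S m).map J.mkQ) = n := by
    intro m
    induction m with
    | zero =>
      have : S 0 = ⊤ := by simp [S]
      rw [this, Submodule.map_top, Submodule.range_mkQ, finrank_top, hJ]
      simp
    | succ m ih =>
      rw [Finset.sum_Icc_succ_top (by omega)]
      have := step m
      omega
  refine ⟨fun i hi => ?_, ?_⟩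
  · obtain ⟨k, rfl⟩ : ∃ k, i = k + 1 := ⟨i - 1, by omega⟩
    have := step k
    have := hz k (by omega)
    omega
  · have := tel n
    have := hz n le_rfl
    omega
end

section
/- Let K be a field of characteristic 0 and R = K[p₁,p₂,…]. Define operators a_m on R for m ∈ ℤ by: a_{−m} = multiplication by p_m and a_m = m·∂/∂p_m for m ≥ 1, and a_0 = 0 (so [a_m,a_n] = m·δ_{m+n,0}·id). For n ∈ ℤ define the Virasoro operator L_n = (1/2)·Σ_{i+j=n} :a_i a_j:, where the normal ordering :a_i a_j: places the operator with positive index to the right (so :a_i a_j: = a_i∘a_j if j ≥ i and a_j∘a_i otherwise); each L_n is a well-defined linear operator on R since only finitely many summands act nonzero on any given polynomial. Then the Virasoro relation holds: [L_n, L_m] = (n−m)·L_{n+m} + ((n³−n)/12)·δ_{n+m,0}·id_R for all n, m ∈ ℤ. -/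
/-- The free-boson Heisenberg operators on `R = K[p₁,p₂,…]` (realized as
`MvPolynomial ℕ+ K`): `a_{−m}` is multiplication by `p_m` and `a_m = m·∂/∂p_m`
for `m ≥ 1`, and `a_0 = 0`. -/
noncomputable def bosonOp {K : Type*} [Field K] (m : ℤ) :
    MvPolynomial ℕ+ K →ₗ[K] MvPolynomial ℕ+ K :=
  if hm : 0 < m then
    ((m : K)) • (MvPolynomial.pderiv (⟨m.toNat, by omega⟩ : ℕ+)).toLinearMap
  else if hm' : m < 0 then
    LinearMap.mulLeft K (MvPolynomial.X (⟨(-m).toNat, by omega⟩ : ℕ+))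
  else 0

/-- The normally ordered product `:a_i a_j:`, which places the operator with positive
index to the right: `:a_i a_j: = a_i ∘ a_j` if `j ≥ i`, and `a_j ∘ a_i` otherwise. -/
noncomputable def normOrd {K : Type*} [Field K] (i j : ℤ) :
    MvPolynomial ℕ+ K →ₗ[K] MvPolynomial ℕ+ K :=
  if i ≤ j then bosonOp i ∘ₗ bosonOp j else bosonOp j ∘ₗ bosonOp i

/-- The Virasoro operator `L_n = (1/2)·Σ_{i+j=n} :a_i a_j:`, defined pointwise via the
finite sum `L_n f = (1/2)·∑ᶠ i, :a_i a_{n−i}: f`. -/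
noncomputable def virasoroOp {K : Type*} [Field K] (n : ℤ) (f : MvPolynomial ℕ+ K) :
    MvPolynomial ℕ+ K :=
  (2 : K)⁻¹ • ∑ᶠ i : ℤ, normOrd i (n - i) f

open MvPolynomial in
theorem bosonOp_natpos {K : Type*} [Field K] (i : ℕ+) (f : MvPolynomial ℕ+ K) :
    bosonOp (i : ℤ) f = (i : K) • pderiv i f := by
  have h : (0 : ℤ) < (i : ℤ) := by exact_mod_cast i.pos
  have h2 : (⟨((i : ℕ) : ℤ).toNat, by omega⟩ : ℕ+) = i := by
    apply PNat.eq; simp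
  unfold bosonOp
  rw [dif_pos h]
  change (((i : ℕ) : ℤ) : K) • pderiv (⟨((i : ℕ) : ℤ).toNat, by omega⟩ : ℕ+) f = _
  rw [h2, Int.cast_natCast]
  rfl

open MvPolynomial in
theorem bosonOp_natneg {K : Type*} [Field K] (i : ℕ+) (f : MvPolynomial ℕ+ K) :
    bosonOp (-(i : ℤ)) f = X i * f := by
  have h : (0 : ℤ) < (i : ℤ) := by exact_mod_cast i.pos
  have h2 : (⟨(-(-((i : ℕ) : ℤ))).toNat, by omega⟩ : ℕ+) = i := by
    apply PNat.eq; simp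
  unfold bosonOp
  rw [dif_neg (by omega), dif_pos (by omega), h2]
  simp

theorem bosonOp_z {K : Type*} [Field K] (f : MvPolynomial ℕ+ K) :
    bosonOp 0 f = 0 := by
  simp [bosonOp]

theorem int_tri (k : ℤ) : k = 0 ∨ (∃ i : ℕ+, k = (i : ℤ)) ∨ (∃ i : ℕ+, k = -(i : ℤ)) := by
  rcases lt_trichotomy k 0 with h | h | h
  · right; right
    exact ⟨⟨(-k).toNat, by omega⟩, by simp; omega⟩
  · left; exact h
  · right; left
    exact ⟨⟨k.toNat, by omega⟩, by simp; omega⟩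

open MvPolynomial in
theorem pderiv_comm' {K : Type*} [Field K] (i j : ℕ+) (f : MvPolynomial ℕ+ K) :
    pderiv i (pderiv j f) = pderiv j (pderiv i f) := by
  ext m
  simp only [coeff_pderiv]
  by_cases h : i = j
  · subst h; rfl
  · rw [add_right_comm]
    simp [Finsupp.single_apply, h, Ne.symm h, mul_right_comm]

open MvPolynomial in
theorem boson_comm {K : Type*} [Field K] (i j : ℤ) (f : MvPolynomial ℕ+ K) :
    bosonOp i (bosonOp j f) = bosonOp j (bosonOp i f) + (if i + j = 0 then (i : K) else 0) • f := by
  rcases int_tri i with rfl | ⟨i, rfl⟩ | ⟨i, rfl⟩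
  · simp [bosonOp_z]
  · have hi := i.pos
    rcases int_tri j with rfl | ⟨j, rfl⟩ | ⟨j, rfl⟩
    · simp [bosonOp_z]
    · have hj := j.pos
      rw [if_neg (by omega)]
      simp only [bosonOp_natpos, map_smul, pderiv_comm' i j, zero_smul, add_zero]
      rw [smul_comm]
    · simp only [bosonOp_natpos, bosonOp_natneg, pderiv_mul]
      by_cases h : i = j
      · subst h
        simp [add_comm]
      · have : ¬ ((i : ℤ) + -(j : ℤ) = 0) := by
          intro h'
          apply h; apply PNat.eq; omega
        rw [if_neg this, pderiv_X_of_ne (Ne.symm h)]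
        simp
  · have hi := i.pos
    rcases int_tri j with rfl | ⟨j, rfl⟩ | ⟨j, rfl⟩
    · simp [bosonOp_z]
    · simp only [bosonOp_natpos, bosonOp_natneg, pderiv_mul]
      by_cases h : i = j
      · subst h
        simp [add_comm]
      · have : ¬ (-(i : ℤ) + (j : ℤ) = 0) := by
          intro h'
          apply h; apply PNat.eq; omega
        rw [if_neg this, pderiv_X_of_ne h]
        simp
    · have hj := j.pos
      rw [if_neg (by omega)]
      simp only [bosonOp_natneg, zero_smul, add_zero]
      ring

theorem boson_kill {K : Type*} [Field K] (f : MvPolynomial ℕ+ K) :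
    ∃ N : ℤ, ∀ k : ℤ, N < k → bosonOp k f = 0 := by
  refine ⟨∑ i ∈ f.vars, (i : ℤ), fun k hk => ?_⟩
  have h0 : (0 : ℤ) ≤ ∑ i ∈ f.vars, (i : ℤ) := Finset.sum_nonneg (fun i _ => by positivity)
  rcases int_tri k with rfl | ⟨i, rfl⟩ | ⟨i, rfl⟩
  · exact bosonOp_z f
  · rw [bosonOp_natpos, MvPolynomial.pderiv_eq_zero_of_notMem_vars, smul_zero]
    intro hi
    have := Finset.single_le_sum (f := fun i : ℕ+ => (i : ℤ)) (fun i _ => by positivity) hi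
    omega
  · have := i.pos
    omega

theorem norm_fin {K : Type*} [Field K] (n : ℤ) (f : MvPolynomial ℕ+ K) :
    (Function.support fun i : ℤ => normOrd i (n - i) f).Finite := by
  obtain ⟨N, hN⟩ := boson_kill f
  apply (Set.finite_Icc (n - N) N).subset
  intro i hi
  by_contra hc
  apply hi
  simp only [Set.mem_Icc, not_and_or, not_le] at hc
  show normOrd i (n - i) f = 0
  unfold normOrd
  split_ifs with h
  · simp only [LinearMap.comp_apply]; rw [hN (n - i) (by omega), map_zero]
  · simp only [LinearMap.comp_apply]; rw [hN i (by omega), map_zero]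

noncomputable def virL (K : Type*) [Field K] (n : ℤ) :
    MvPolynomial ℕ+ K →ₗ[K] MvPolynomial ℕ+ K where
  toFun := virasoroOp n
  map_add' f g := by
    unfold virasoroOp
    rw [← smul_add, ← finsum_add_distrib (norm_fin n f) (norm_fin n g)]
    simp
  map_smul' c f := by
    unfold virasoroOp
    rw [RingHom.id_apply, smul_comm, smul_finsum' c (norm_fin n f)]
    simp

theorem virL_apply {K : Type*} [Field K] (n : ℤ) (f : MvPolynomial ℕ+ K) :
    virL K n f = (2 : K)⁻¹ • ∑ᶠ i : ℤ, normOrd i (n - i) f := rfl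

theorem normOrd_eq {K : Type*} [Field K] (i j : ℤ) : ∃ c : K, ∀ f : MvPolynomial ℕ+ K,
    normOrd i j f = bosonOp i (bosonOp j f) + c • f := by
  by_cases h : i ≤ j
  · exact ⟨0, fun f => by simp [normOrd, h]⟩
  · exact ⟨_, fun f => by simp only [normOrd, h, if_false]; exact boson_comm j i f⟩

theorem boson_normOrd {K : Type*} [Field K] (k i j : ℤ) (f : MvPolynomial ℕ+ K) :
    bosonOp k (normOrd i j f) - normOrd i j (bosonOp k f) =
      (if k + i = 0 then (k : K) else 0) • bosonOp j f +
      (if k + j = 0 then (k : K) else 0) • bosonOp i f := by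
  obtain ⟨c, hc⟩ := normOrd_eq (K := K) i j
  rw [hc, hc, map_add, map_smul, boson_comm k i, boson_comm k j, map_add, map_smul]
  abel

theorem boson_vir {K : Type*} [Field K] [CharZero K] (k n : ℤ) (f : MvPolynomial ℕ+ K) :
    bosonOp k (virL K n f) = virL K n (bosonOp k f) + (k : K) • bosonOp (k + n) f := by
  rw [← sub_eq_iff_eq_add', virL_apply, virL_apply, map_smul, ← smul_sub,
    map_finsum _ (norm_fin n f), ← finsum_sub_distrib _ (norm_fin n (bosonOp k f))]
  · simp only [boson_normOrd]
    have e1 : ∀ x : ℤ, x ≠ -k →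
        (if k + x = 0 then (k : K) else 0) • bosonOp (n - x) f = 0 := by
      intro x hx
      rw [if_neg (by omega), zero_smul]
    have e2 : ∀ x : ℤ, x ≠ n + k →
        (if k + (n - x) = 0 then (k : K) else 0) • bosonOp x f = 0 := by
      intro x hx
      rw [if_neg (by omega), zero_smul]
    rw [finsum_add_distrib, finsum_eq_single _ _ e1, finsum_eq_single _ _ e2,
      if_pos (by omega), if_pos (by omega), show n - -k = k + n by ring, add_comm n k,
      ← two_smul K, smul_smul, inv_mul_cancel₀ two_ne_zero, one_smul]
    · apply (Set.finite_singleton (-k)).subset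
      intro x hx
      by_contra hc
      exact hx (e1 x hc)
    · apply (Set.finite_singleton (n + k)).subset
      intro x hx
      by_contra hc
      exact hx (e2 x hc)
  · apply (norm_fin n f).subset
    intro x hx hc
    apply hx
    simp only at hc
    simp [hc]

open MvPolynomial in
theorem schur {K : Type*} [Field K] [CharZero K] (T : MvPolynomial ℕ+ K →ₗ[K] MvPolynomial ℕ+ K)
    (hT : ∀ k f, bosonOp k (T f) = T (bosonOp k f)) (f : MvPolynomial ℕ+ K) :
    T f = constantCoeff (T 1) • f := by
  have h1 : T 1 = C (constantCoeff (T 1)) := by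
    ext m
    rw [coeff_C]
    split_ifs with h
    · subst h; rfl
    · obtain ⟨i, hi⟩ : ∃ i, m i ≠ 0 := by
        by_contra hc
        push Not at hc
        exact h (Finsupp.ext (fun i => (hc i).symm))
      have h2 := hT i 1
      rw [bosonOp_natpos, bosonOp_natpos, pderiv_one, smul_zero, map_zero] at h2
      have h3 : pderiv i (T 1) = 0 := by
        rcases smul_eq_zero.mp h2 with h | h
        · exact absurd h (by exact_mod_cast i.ne_zero)
        · exact h
      have h4 := congrArg (coeff (m - Finsupp.single i 1)) h3
      rw [coeff_pderiv, coeff_zero, tsub_add_cancel_of_le] at h4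
      · rcases mul_eq_zero.mp h4 with h | h
        · exact h
        · exact absurd h (Nat.cast_add_one_ne_zero _)
      · rw [Finsupp.single_le_iff]; omega
  induction f using MvPolynomial.induction_on with
  | C a =>
    rw [show (C a : MvPolynomial ℕ+ K) = a • 1 by rw [smul_eq_C_mul, mul_one], map_smul]
    conv_lhs => rw [h1]
    rw [smul_eq_C_mul, smul_eq_C_mul, smul_eq_C_mul]
    ring
  | add p q hp hq => rw [map_add, hp, hq, smul_add]
  | mul_X p i hp =>
    have := hT (-(i : ℤ)) p
    rw [bosonOp_natneg, bosonOp_natneg, hp] at this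
    rw [mul_comm p, ← this, mul_smul_comm]

open MvPolynomial in
theorem cc_boson {K : Type*} [Field K] (k : ℤ) (hk : k ≤ 0) (f : MvPolynomial ℕ+ K) :
    constantCoeff (bosonOp k f) = 0 := by
  rcases int_tri k with rfl | ⟨i, rfl⟩ | ⟨i, rfl⟩
  · simp [bosonOp_z]
  · have := i.pos
    omega
  · simp [bosonOp_natneg]

theorem boson_one {K : Type*} [Field K] (k : ℤ) (hk : 0 ≤ k) :
    bosonOp k (1 : MvPolynomial ℕ+ K) = 0 := by
  rcases int_tri k with rfl | ⟨i, rfl⟩ | ⟨i, rfl⟩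
  · simp [bosonOp_z]
  · simp [bosonOp_natpos]
  · have := i.pos
    omega

open MvPolynomial in
theorem cc_vir {K : Type*} [Field K] (n : ℤ) (hn : n ≤ 0) (f : MvPolynomial ℕ+ K) :
    constantCoeff (virL K n f) = 0 := by
  rw [virL_apply, constantCoeff_smul, map_finsum _ (norm_fin n f)]
  have : ∀ i : ℤ, constantCoeff (normOrd i (n - i) f) = 0 := by
    intro i
    unfold normOrd
    split_ifs with h
    · exact cc_boson _ (by omega) _
    · exact cc_boson _ (by omega) _
  simp [this]

theorem vir_one {K : Type*} [Field K] (n : ℤ) (hn : 0 ≤ n) :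
    virL K n 1 = 0 := by
  rw [virL_apply]
  have : ∀ i : ℤ, normOrd i (n - i) (1 : MvPolynomial ℕ+ K) = 0 := by
    intro i
    unfold normOrd
    split_ifs with h
    · rw [LinearMap.comp_apply, boson_one _ (by omega), map_zero]
    · rw [LinearMap.comp_apply, boson_one _ (by omega), map_zero]
  simp [this]

open MvPolynomial in
theorem cc_term {K : Type*} [Field K] [CharZero K] (n m i : ℤ) (hn : 0 < n) (hm : m < 0) :
    constantCoeff (virL K n (normOrd i (m - i) 1)) =
      if n + m = 0 ∧ m < i ∧ i < 0 then -(i : K) * (i + n) else 0 := by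
  by_cases h : m < i ∧ i < 0
  · have e : normOrd i (m - i) (1 : MvPolynomial ℕ+ K) = bosonOp i (bosonOp (m - i) 1) := by
      unfold normOrd
      split_ifs with h
      · rfl
      · rw [LinearMap.comp_apply, boson_comm, if_neg (by omega), zero_smul, add_zero]
    have e2 := boson_vir i n (bosonOp (m - i) (1 : MvPolynomial ℕ+ K))
    rw [← sub_eq_iff_eq_add] at e2
    rw [e, ← e2, map_sub, cc_boson _ (by omega), constantCoeff_smul, zero_sub]
    by_cases h3 : 0 ≤ i + n
    · rw [boson_comm, boson_one _ h3, map_zero, zero_add, constantCoeff_smul]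
      by_cases h4 : n + m = 0
      · rw [if_pos (by omega), if_pos (by omega)]
        simp
      · rw [if_neg (by omega), if_neg (by omega)]
        simp
    · rw [cc_boson _ (by omega), if_neg (by omega)]
      simp
  · rw [if_neg (by tauto)]
    have e : normOrd i (m - i) (1 : MvPolynomial ℕ+ K) = 0 := by
      unfold normOrd
      split_ifs with h
      · rw [LinearMap.comp_apply, boson_one (m - i) (by omega), map_zero]
      · rw [LinearMap.comp_apply, boson_one i (by omega), map_zero]
    rw [e, map_zero, map_zero]

theorem sum_aux {K : Type*} [Field K] [CharZero K] (c : K) (M : ℕ) :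
    ∑ j ∈ Finset.range (M + 1), (j : K) * (c - j) =
      c * M * (M + 1) / 2 - M * (M + 1) * (2 * M + 1) / 6 := by
  induction M with
  | zero => simp
  | succ M ih =>
    rw [Finset.sum_range_succ, ih]
    push_cast
    field_simp
    ring

open MvPolynomial in
theorem cc_virvir {K : Type*} [Field K] [CharZero K] (n m : ℤ) (hn : 0 < n) :
    constantCoeff (virL K n (virL K m 1)) =
      if n + m = 0 then ((n : K) ^ 3 - n) / 12 else 0 := by
  by_cases hm : 0 ≤ m
  · rw [vir_one m hm, if_neg (by omega)]; simp
  push Not at hm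
  have hf : (Function.support fun i : ℤ => virL K n (normOrd i (m - i) 1)).Finite := by
    apply (norm_fin m (1 : MvPolynomial ℕ+ K)).subset
    intro x hx hc
    apply hx
    simp only at hc
    simp [hc]
  rw [virL_apply m, map_smul, constantCoeff_smul, map_finsum _ (norm_fin m 1), map_finsum _ hf]
  simp only [cc_term n m _ hn hm]
  by_cases h : n + m = 0
  · rw [if_pos h]
    obtain ⟨N, rfl⟩ := Int.eq_ofNat_of_zero_le hn.le
    obtain rfl : m = -(N : ℤ) := by omega
    rw [finsum_eq_sum_of_support_subset
      (s := (Finset.range (N + 1)).image (fun j : ℕ => -(j : ℤ)))]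
    · rw [Finset.sum_image (by intro a _ b _ hab; simpa using hab)]
      have : ∀ j ∈ Finset.range (N + 1), (if (N : ℤ) + -(N : ℤ) = 0 ∧ -(N : ℤ) < -(j : ℤ) ∧ -(j : ℤ) < 0
          then -((-(j : ℤ) : ℤ) : K) * (((-(j : ℤ) : ℤ) : K) + ((N : ℤ) : K)) else 0)
          = (j : K) * ((N : K) - j) := by
        intro j hj
        rw [Finset.mem_range] at hj
        split_ifs with h
        · push_cast; ring
        · have : j = 0 ∨ j = N := by omega
          rcases this with rfl | rfl <;> simp
      rw [Finset.sum_congr rfl this, sum_aux]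
      push_cast
      rw [smul_eq_mul]
      field_simp
      ring
    · intro x hx
      rw [Function.mem_support] at hx
      have : -(N : ℤ) < x ∧ x < 0 := by
        by_contra hc
        exact hx (if_neg (by tauto))
      simp only [Finset.coe_image, Set.mem_image, Finset.coe_range, Set.mem_Iio]
      exact ⟨(-x).toNat, by omega, by omega⟩
  · simp [h]

theorem virasoro_relation {K : Type*} [Field K] [CharZero K] :
    (∀ (n : ℤ) (f : MvPolynomial ℕ+ K),
      (Function.support fun i : ℤ => normOrd i (n - i) f).Finite)
    ∧ (∀ (n m : ℤ) (f : MvPolynomial ℕ+ K),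
        virasoroOp n (virasoroOp m f) - virasoroOp m (virasoroOp n f)
          = ((n : K) - (m : K)) • virasoroOp (n + m) f
            + ((((n : K) ^ 3 - (n : K)) / 12) • if n + m = 0 then f else 0)) := by
  refine ⟨norm_fin, fun n m f => ?_⟩
  show virL K n (virL K m f) - virL K m (virL K n f) = ((n : K) - (m : K)) • virL K (n + m) f + _
  let T : MvPolynomial ℕ+ K →ₗ[K] MvPolynomial ℕ+ K :=
    virL K n ∘ₗ virL K m - virL K m ∘ₗ virL K n - ((n : K) - (m : K)) • virL K (n + m)
  have hTf : ∀ f, T f = virL K n (virL K m f) - virL K m (virL K n f)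
    - ((n : K) - (m : K)) • virL K (n + m) f := fun f => rfl
  have hT : ∀ k f, bosonOp k (T f) = T (bosonOp k f) := by
    intro k f
    rw [hTf, hTf]
    simp only [map_sub, map_smul, boson_vir, map_add]
    rw [show k + m + n = k + (n + m) by ring, show k + n + m = k + (n + m) by ring]
    push_cast
    module
  have h := schur T hT f
  have hc : MvPolynomial.constantCoeff (T 1) =
      if n + m = 0 then ((n : K) ^ 3 - n) / 12 else 0 := by
    rw [hTf, map_sub, map_sub, MvPolynomial.constantCoeff_smul]
    have h0 : MvPolynomial.constantCoeff (virL K (n + m) 1) = 0 := by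
      rcases le_total (n + m) 0 with h | h
      · exact cc_vir _ h _
      · rw [vir_one _ h, map_zero]
    rw [h0, smul_zero, sub_zero]
    rcases lt_trichotomy n 0 with hn | rfl | hn
    · rw [cc_vir n hn.le]
      by_cases hm : 0 < m
      · rw [cc_virvir m n hm, add_comm m n]
        split_ifs with h
        · obtain rfl : m = -n := by omega
          push_cast
          ring
        · simp
      · rw [cc_vir m (by omega), if_neg (by omega), sub_zero]
    · rw [cc_vir 0 le_rfl, vir_one 0 le_rfl]
      simp
    · rw [cc_virvir n m hn]
      by_cases hm : 0 < m
      · rw [vir_one n hn.le]; simp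
      · rw [cc_vir m (by omega), sub_zero]
  rw [hTf, hc, sub_eq_iff_eq_add'] at h
  rw [h]
  split_ifs <;> simp
end
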